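/- Let γ ∈ [0,1], a ≥ 0 and δ > 0 satisfy (1−γ)·a < √(2T(γa)) and δ = (√(2T(γa)) − (1−γ)a)². Then δ ≤ 2Φ(−γa)·(1 − (1−γ)a/√(2T(γa))). -/

import Mathlib

noncomputable section

/-- Standard normal density `φ(z) = exp(−z²/2)/√(2π)`. -/
def gpdf (z : ℝ) : ℝ := Real.exp (-z ^ 2 / 2) / Real.sqrt (2 * Real.pi)

/-- Standard normal cumulative distribution function `Φ(z) = ∫_{−∞}^z φ(x) dx`. -/
def gcdf (z : ℝ) : ℝ := ∫ x in Set.Iic z, gpdf x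

/-- `T(z) = (1 + z²)Φ(−z) − zφ(z)`. -/
def Tfun (z : ℝ) : ℝ := (1 + z ^ 2) * gcdf (-z) - z * gpdf z

lemma integrable_gpdf : MeasureTheory.Integrable gpdf := by
  have h := (integrable_exp_neg_mul_sq (b := 1 / 2) (by norm_num)).div_const
    (Real.sqrt (2 * Real.pi))
  refine h.congr (Filter.Eventually.of_forall fun x => ?_)
  simp only [gpdf]
  ring_nf

lemma integrable_neg_mul_gpdf : MeasureTheory.Integrable fun x => -x * gpdf x := by
  have h := ((integrable_mul_exp_neg_mul_sq (b := 1 / 2) (by norm_num)).div_const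
    (Real.sqrt (2 * Real.pi))).neg
  refine h.congr (Filter.Eventually.of_forall fun x => ?_)
  simp only [gpdf, Pi.neg_apply]
  ring_nf

lemma hasDerivAt_gpdf (x : ℝ) : HasDerivAt gpdf (-x * gpdf x) x := by
  have h : HasDerivAt (fun z : ℝ => -z ^ 2 / 2) (-x) x :=
    ((hasDerivAt_pow 2 x).neg.div_const 2).congr_deriv (by simp; ring)
  refine (h.exp.div_const (Real.sqrt (2 * Real.pi))).congr_deriv ?_
  simp only [gpdf]
  ring

lemma setIntegral_Iic_neg_mul_gpdf (z : ℝ) : ∫ x in Set.Iic z, -x * gpdf x = gpdf z := by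
  have h := MeasureTheory.integral_Iic_of_hasDerivAt_of_tendsto' (a := z)
    (fun x _ => hasDerivAt_gpdf x) integrable_neg_mul_gpdf.integrableOn
    (MeasureTheory.tendsto_zero_of_hasDerivAt_of_integrableOn_Iic (a := z)
      (fun x _ => hasDerivAt_gpdf x) integrable_neg_mul_gpdf.integrableOn
      integrable_gpdf.integrableOn)
  simpa using h

lemma gpdf_nonneg (x : ℝ) : 0 ≤ gpdf x := by
  unfold gpdf
  positivity

/-- The Mills ratio bound `zΦ(−z) ≤ φ(z)`. -/
lemma mul_gcdf_neg_le_gpdf (z : ℝ) : z * gcdf (-z) ≤ gpdf z := by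
  have hz : gpdf z = gpdf (-z) := by simp [gpdf]
  rw [hz, ← setIntegral_Iic_neg_mul_gpdf, gcdf, ← MeasureTheory.integral_const_mul]
  refine MeasureTheory.setIntegral_mono_on (integrable_gpdf.const_mul z).integrableOn
    integrable_neg_mul_gpdf.integrableOn measurableSet_Iic fun x hx => ?_
  exact mul_le_mul_of_nonneg_right (le_neg_of_le_neg hx) (gpdf_nonneg x)

lemma Tfun_le_gcdf_neg {z : ℝ} (hz : 0 ≤ z) : Tfun z ≤ gcdf (-z) := by
  unfold Tfun
  linarith [mul_le_mul_of_nonneg_left (mul_gcdf_neg_le_gpdf z) hz]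

/-- if `(1−γ)a < √(2T(γa))` and `δ = (√(2T(γa)) − (1−γ)a)²`, then
`δ ≤ 2Φ(−γa)(1 − (1−γ)a/√(2T(γa)))`. -/
theorem calibration_negativity (γ a δ : ℝ) (hγ0 : 0 ≤ γ) (hγ1 : γ ≤ 1) (ha : 0 ≤ a)
    (h1 : (1 - γ) * a < Real.sqrt (2 * Tfun (γ * a)))
    (h2 : δ = (Real.sqrt (2 * Tfun (γ * a)) - (1 - γ) * a) ^ 2) :
    δ ≤ 2 * gcdf (-(γ * a)) * (1 - (1 - γ) * a / Real.sqrt (2 * Tfun (γ * a))) := by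
  have hT := Tfun_le_gcdf_neg (mul_nonneg hγ0 ha)
  have hb : 0 ≤ (1 - γ) * a := mul_nonneg (sub_nonneg.2 hγ1) ha
  have hs : 0 < Real.sqrt (2 * Tfun (γ * a)) := hb.trans_lt h1
  have hsq := Real.sq_sqrt (Real.sqrt_pos.1 hs).le
  subst h2
  generalize Real.sqrt (2 * Tfun (γ * a)) = s at *
  generalize (1 - γ) * a = b at *
  rw [one_sub_div hs.ne', mul_div_assoc', le_div_iff₀ hs]
  have hle : s * (s - b) ≤ 2 * gcdf (-(γ * a)) := by nlinarith
  calc (s - b) ^ 2 * s = s * (s - b) * (s - b) := by ring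
    _ ≤ 2 * gcdf (-(γ * a)) * (s - b) :=
      mul_le_mul_of_nonneg_right hle (sub_nonneg.2 h1.le)
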